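/- Let b ≥ 2, σ a permutation of {0,…,b−1} and σ̄ = τ∘σ where τ(k) = b−1−k. Then for every h ∈ {1,…,b−1} and every x ∈ ℝ, φ_{b,h}^{σ̄}(x) = −φ_{b,b−h}^σ(x); consequently φ_b^σ = −φ_b^{σ̄} and φ_b^{σ,(2)} = φ_b^{σ̄,(2)}. -/

import Mathlib

open Finset
open scoped Classical

noncomputable section

namespace SymHamm

/-- The reversal permutation `τ(k) = b−1−k` on `{0,…,b−1}`. -/
def tauP (b : ℕ) : Equiv.Perm (Fin b) := Fin.revPerm

/-- `σ̄ = τ ∘ σ`. -/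
def pbar {b : ℕ} (σ : Equiv.Perm (Fin b)) : Equiv.Perm (Fin b) := σ.trans (tauP b)

/-- Value of a permutation of `Fin b` on a natural number. -/
def permVal {b : ℕ} (σ : Equiv.Perm (Fin b)) (k : ℕ) : ℕ :=
  if h : k < b then (σ ⟨k, h⟩ : ℕ) else 0

/-- Faure's function `φ_{b,h}^σ`, extended with period 1 to all of `ℝ`.
For `x ∈ [(k−1)/b, k/b)` (i.e. `k−1 = ⌊b·{x}⌋`), it equals
`A([0,h/b);k;Z_b^σ) − h·x` if `h ≤ σ(k−1)` and `(b−h)·x − A([h/b,1);k;Z_b^σ)` otherwise,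
where `A` counts the first `k` entries `σ(0)/b,…,σ(k−1)/b` of `Z_b^σ` in the interval. -/
def phi {b : ℕ} (σ : Equiv.Perm (Fin b)) (h : ℕ) (x : ℝ) : ℝ :=
  if h ≤ permVal σ (⌊(b : ℝ) * Int.fract x⌋).toNat then
    (((Finset.range ((⌊(b : ℝ) * Int.fract x⌋).toNat + 1)).filter
        (fun l => permVal σ l < h)).card : ℝ) - (h : ℝ) * Int.fract x
  else
    ((b : ℝ) - (h : ℝ)) * Int.fract x -
      (((Finset.range ((⌊(b : ℝ) * Int.fract x⌋).toNat + 1)).filter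
        (fun l => h ≤ permVal σ l)).card : ℝ)

/-- `φ_b^σ = ∑_{h=0}^{b−1} φ_{b,h}^σ`. -/
def phiS {b : ℕ} (σ : Equiv.Perm (Fin b)) (x : ℝ) : ℝ := ∑ h ∈ range b, phi σ h x

/-- `φ_b^{σ,(2)} = ∑_{h=0}^{b−1} (φ_{b,h}^σ)²`. -/
def phiS2 {b : ℕ} (σ : Equiv.Perm (Fin b)) (x : ℝ) : ℝ := ∑ h ∈ range b, (phi σ h x) ^ 2

/-- `φ̃_b^σ = ∑_{h=0}^{b−1} φ_{b,h}^σ · φ_{b,h}^{σ̄}`. -/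
def phiT {b : ℕ} (σ : Equiv.Perm (Fin b)) (x : ℝ) : ℝ :=
  ∑ h ∈ range b, phi σ h x * phi (pbar σ) h x

/-- `φ̃_{b,1}^σ = ∑_{h=0}^{b−2} φ_{b,h+1}^σ · φ_{b,h}^{σ̄}`. -/
def phiT1 {b : ℕ} (σ : Equiv.Perm (Fin b)) (x : ℝ) : ℝ :=
  ∑ h ∈ range (b - 1), phi σ (h + 1) x * phi (pbar σ) h x

/-- `φ̃_{b,2}^σ = ∑_{h=0}^{b−2} φ_{b,h}^σ · φ_{b,h+1}^{σ̄}`. -/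
def phiT2 {b : ℕ} (σ : Equiv.Perm (Fin b)) (x : ℝ) : ℝ :=
  ∑ h ∈ range (b - 1), phi σ h x * phi (pbar σ) (h + 1) x

/-- `Φ_b^σ = (1/b)·∫_0^1 φ_b^σ`. -/
def PhiS {b : ℕ} (σ : Equiv.Perm (Fin b)) : ℝ := (1 / (b : ℝ)) * ∫ x in (0:ℝ)..1, phiS σ x

/-- `Φ_b^{σ,(2)} = (1/b)·∫_0^1 φ_b^{σ,(2)}`. -/
def PhiS2 {b : ℕ} (σ : Equiv.Perm (Fin b)) : ℝ := (1 / (b : ℝ)) * ∫ x in (0:ℝ)..1, phiS2 σ x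

/-- `Φ̃_b^σ = (1/b)·∫_0^1 φ̃_b^σ`. -/
def PhiT {b : ℕ} (σ : Equiv.Perm (Fin b)) : ℝ := (1 / (b : ℝ)) * ∫ x in (0:ℝ)..1, phiT σ x

/-- `Φ̃_{b,1}^σ = (1/b)·∫_0^1 φ̃_{b,1}^σ`. -/
def PhiT1 {b : ℕ} (σ : Equiv.Perm (Fin b)) : ℝ := (1 / (b : ℝ)) * ∫ x in (0:ℝ)..1, phiT1 σ x

/-- `Φ̃_{b,2}^σ = (1/b)·∫_0^1 φ̃_{b,2}^σ`. -/
def PhiT2 {b : ℕ} (σ : Equiv.Perm (Fin b)) : ℝ := (1 / (b : ℝ)) * ∫ x in (0:ℝ)..1, phiT2 σ x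

/-- `ν_j(N,Σ) = σ_j(N_j)·b^{n−j−1} + … + σ_{n−1}(N_{n−1})`, where `N_i` is the `i`-th
`b`-adic digit of `N`. -/
def nu (b n : ℕ) (S : Fin n → Equiv.Perm (Fin b)) (N j : ℕ) : ℕ :=
  ∑ i : Fin n,
    if j ≤ (i : ℕ) then permVal (S i) ((N / b ^ (i : ℕ)) % b) * b ^ (n - 1 - (i : ℕ)) else 0

/-- `ε_j(λ,N,Σ)`, for `1 ≤ j ≤ n`: it is `0` when `λ = bⁿ` or `N = bⁿ`; it is the last digit
`λ_n = λ % b` when `j = n`; otherwise, with `Λ_{j−1} = λ % b^{n−j+1}` and `ν_j = ν_j(N,Σ)`,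
it is `0` if `Λ_{j−1} ≤ ν_j`, it is `h` if `ν_j + (h−1)b^{n−j} < Λ_{j−1} ≤ ν_j + h·b^{n−j}`
for some `1 ≤ h < b`, and `0` if `ν_j + (b−1)b^{n−j} < Λ_{j−1} < b^{n−j+1}`. -/
def eps (b n : ℕ) (S : Fin n → Equiv.Perm (Fin b)) (lam N j : ℕ) : ℕ :=
  if lam = b ^ n ∨ N = b ^ n then 0
  else if j = n then lam % b
  else if lam % b ^ (n - j + 1) ≤ nu b n S N j then 0
  else ((lam % b ^ (n - j + 1) - nu b n S N j - 1) / b ^ (n - j) + 1) % b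

/-- The point of the digit-scrambled Hammersley point set `R_{b,n}^Σ` with digits `a`:
`(∑_{j=0}^{n−1} σ_j(a_j)/b^{n−j}, ∑_{j=0}^{n−1} a_j/b^{j+1})`. -/
def hammPt (b n : ℕ) (S : Fin n → Equiv.Perm (Fin b)) (a : Fin n → Fin b) : ℝ × ℝ :=
  (∑ j : Fin n, ((S j (a j) : ℕ) : ℝ) / (b : ℝ) ^ (n - (j : ℕ)),
   ∑ j : Fin n, ((a j : ℕ) : ℝ) / (b : ℝ) ^ ((j : ℕ) + 1))

/-- The symmetrized Hammersley point set `R_{b,n}^{Σ,sym} = R_{b,n}^Σ ∪ R_{b,n}^{Σ*}`,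
a family of `2·bⁿ` points. -/
def symFam (b n : ℕ) (S : Fin n → Equiv.Perm (Fin b)) :
    Bool × (Fin n → Fin b) → ℝ × ℝ :=
  fun p => if p.1 then hammPt b n S p.2 else hammPt b n (fun i => pbar (S i)) p.2

/-- Local discrepancy `E(x,y,P) = #{i : P i ∈ [0,x)×[0,y)} − N·x·y` of a finite family of
points, where `N` is the number of points. -/
def localDisc {ι : Type} [Fintype ι] (P : ι → ℝ × ℝ) (x y : ℝ) : ℝ :=
  ((Finset.univ.filter
      (fun i => 0 ≤ (P i).1 ∧ (P i).1 < x ∧ 0 ≤ (P i).2 ∧ (P i).2 < y)).card : ℝ)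
    - (Fintype.card ι : ℝ) * x * y

/-- `L_2` discrepancy `L2(P) = (1/N)·(∫_0^1∫_0^1 E(x,y,P)² dx dy)^{1/2}`. -/
def L2disc {ι : Type} [Fintype ι] (P : ι → ℝ × ℝ) : ℝ :=
  (1 / (Fintype.card ι : ℝ)) *
    Real.sqrt (∫ x in (0:ℝ)..1, ∫ y in (0:ℝ)..1, (localDisc P x y) ^ 2)


theorem permVal_lt {b : ℕ} (σ : Equiv.Perm (Fin b)) {k : ℕ} (hk : k < b) :
    permVal σ k < b := by
  simp [permVal, hk]

theorem permVal_pbar {b : ℕ} (σ : Equiv.Perm (Fin b)) {k : ℕ} (hk : k < b) :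
    permVal (pbar σ) k = b - 1 - permVal σ k := by
  simp only [permVal, hk, dif_pos, pbar, tauP, Equiv.trans_apply, Fin.revPerm_apply, Fin.val_rev]
  omega

theorem toNat_floor_mul_fract_lt {b : ℕ} (hb : 0 < b) (x : ℝ) :
    (⌊(b : ℝ) * Int.fract x⌋).toNat < b := by
  have hb' : (0 : ℝ) < b := by exact_mod_cast hb
  have h1 : (b : ℝ) * Int.fract x < b := by nlinarith [Int.fract_lt_one x]
  have h2 : ⌊(b : ℝ) * Int.fract x⌋ < (b : ℤ) := Int.floor_lt.2 (by exact_mod_cast h1)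
  omega

theorem phi_zero {b : ℕ} (σ : Equiv.Perm (Fin b)) (x : ℝ) : phi σ 0 x = 0 := by
  simp [phi]

theorem phi_pbar {b : ℕ} (σ : Equiv.Perm (Fin b)) {h : ℕ} (h1 : 1 ≤ h) (h2 : h < b) (x : ℝ) :
    phi (pbar σ) h x = -phi σ (b - h) x := by
  have hk := toNat_floor_mul_fract_lt (by omega : 0 < b) x
  unfold phi
  set k := (⌊(b : ℝ) * Int.fract x⌋).toNat
  have low : (range (k + 1)).filter (fun l => permVal (pbar σ) l < h) =
      (range (k + 1)).filter (fun l => b - h ≤ permVal σ l) := by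
    refine filter_congr fun l hl => ?_
    have hlb : l < b := by have := mem_range.1 hl; omega
    have := permVal_lt σ hlb
    rw [permVal_pbar σ hlb]
    omega
  have high : (range (k + 1)).filter (fun l => h ≤ permVal (pbar σ) l) =
      (range (k + 1)).filter (fun l => permVal σ l < b - h) := by
    refine filter_congr fun l hl => ?_
    have hlb : l < b := by have := mem_range.1 hl; omega
    have := permVal_lt σ hlb
    rw [permVal_pbar σ hlb]
    omega
  have hσ := permVal_lt σ hk
  rw [low, high, permVal_pbar σ hk, Nat.cast_sub h2.le]
  by_cases hc : b - h ≤ permVal σ k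
  · rw [if_neg (by omega), if_pos hc]
    ring
  · rw [if_pos (by omega), if_neg hc]
    ring

/-- Reflecting `h ↦ b - h` on `{1, …, b - 1}` preserves a sum whose term at `0` vanishes. -/
theorem sum_range_reflect_of_zero {b : ℕ} (hb : 0 < b) (f g : ℕ → ℝ) (h0 : f 0 = g 0)
    (hfg : ∀ h, 1 ≤ h → h < b → f h = g (b - h)) :
    ∑ h ∈ range b, f h = ∑ h ∈ range b, g h := by
  obtain ⟨n, rfl⟩ : ∃ n, b = n + 1 := ⟨b - 1, by omega⟩
  rw [sum_range_succ', sum_range_succ', h0, ← sum_range_reflect (fun i => g (i + 1)) n]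
  congr 1
  refine sum_congr rfl fun i hi => ?_
  have hi' := mem_range.1 hi
  rw [hfg (i + 1) (by omega) (by omega)]
  congr 1
  omega

theorem stmt6 (b : ℕ) (hb : 2 ≤ b) (σ : Equiv.Perm (Fin b)) :
    (∀ h : ℕ, 1 ≤ h → h ≤ b - 1 → ∀ x : ℝ, phi (pbar σ) h x = -phi σ (b - h) x)
      ∧ (∀ x : ℝ, phiS σ x = -phiS (pbar σ) x)
      ∧ (∀ x : ℝ, phiS2 σ x = phiS2 (pbar σ) x) := by
  refine ⟨fun h h1 h2 x => phi_pbar σ h1 (by omega) x, fun x => ?_, fun x => ?_⟩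
  · rw [eq_neg_iff_add_eq_zero, add_comm, ← eq_neg_iff_add_eq_zero]
    unfold phiS
    rw [← sum_neg_distrib]
    refine sum_range_reflect_of_zero (by omega) _ _ (by simp [phi_zero]) fun h h1 h2 => ?_
    exact phi_pbar σ h1 h2 x
  · symm
    unfold phiS2
    refine sum_range_reflect_of_zero (by omega) _ _ (by simp [phi_zero]) fun h h1 h2 => ?_
    rw [phi_pbar σ h1 h2 x, neg_sq]

end SymHamm
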